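/- Let n ≥ 4, 1 ≤ k ≤ n−3 and k+1 ≤ p ≤ n, and let Λ = ℤv₁ + ⋯ + ℤv_k be the rank-k lattice spanned by ℝ-linearly independent vectors v₁, …, v_k ∈ ℝⁿ whose coordinates k+1, …, n all vanish. For ε = (ε_{k+1},…,ε_p) ∈ {±1}^{p−k} let R_ε : ℝⁿ → ℝⁿ be the linear isometry R_ε(x) = (x₁,…,x_k, ε_{k+1}x_{k+1},…,ε_p x_p, x_{p+1},…,x_n). Then: (i) for all x, y ∈ ℝⁿ such that R_ε(x) + ω ≠ y for every ε ∈ {±1}^{p−k} and ω ∈ Λ, the family (|R_ε(x) + ω − y|^{2−n})_{(ε,ω)} is summable, so K(x,y) = Σ_{ε ∈ {±1}^{p−k}} Σ_{ω∈Λ} |R_ε(x) + ω − y|^{2−n} is well defined; (ii) K(x+v_i, y) = K(x,y) for every i = 1, …, k; (iii) K(R_δ(x), y) = K(x,y) for every δ ∈ {±1}^{p−k}; (iv) for each fixed y, the function x ↦ K(x,y) is harmonic on the open set {x ∈ ℝⁿ : R_ε(x) + ω ≠ y for all ε, ω}. -/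

import Mathlib

noncomputable section

abbrev Euc (n : ℕ) := EuclideanSpace ℝ (Fin n)

/-- The lattice point `m₁v₁ + ⋯ + m_kv_k` associated to integer coefficients `m`. -/
def latt {n k : ℕ} (v : Fin k → Euc n) (m : Fin k → ℤ) : Euc n :=
  ∑ i, (m i : ℝ) • v i

/-- The lattice `Λ = ℤv₁ + ⋯ + ℤv_k` spanned by the vectors `v i`. -/
def lattice {n k : ℕ} (v : Fin k → Euc n) : Set (Euc n) := Set.range (latt v)

/-- A sign pattern `ε ∈ {±1}^{p-k}`, encoded by the set of flipped coordinates: `ε j = true`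
is allowed only for coordinates `j` with `k+1 ≤ j ≤ p` (0-indexed: `k ≤ j < p`). -/
def SignWindow (n k p : ℕ) (ε : Fin n → Bool) : Prop :=
  ∀ j : Fin n, ε j = true → k ≤ (j : ℕ) ∧ (j : ℕ) < p

/-- The linear isometry `R_ε` flipping the signs of the coordinates selected by `ε`. -/
def Rflip {n : ℕ} (ε : Fin n → Bool) (x : Euc n) : Euc n :=
  x - ∑ j ∈ Finset.univ.filter (fun j : Fin n => ε j = true),
    (2 * x j) • EuclideanSpace.single j 1

open Filter Topology

theorem Real.rpow_sub_le_of_half_le {r c δ s t : ℝ} (hr : r ≤ 0) (hc : 0 ≤ c) (hδ : 0 < δ)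
    (ht : 0 < t) (hs : δ ≤ s) (hts : t / 2 ≤ s) :
    s ^ (r - c) ≤ δ ^ (-c) * ((1 / 2) ^ r * t ^ r) := by
  have hs0 : 0 < s := hδ.trans_le hs
  rw [← Real.mul_rpow (by norm_num) ht.le, sub_eq_neg_add, Real.rpow_add hs0]
  exact mul_le_mul (Real.rpow_le_rpow_of_nonpos hδ hs (by linarith))
    (Real.rpow_le_rpow_of_nonpos (by positivity) (by linarith) hr) (by positivity) (by positivity)

theorem exists_pos_le_norm_of_summable_norm_rpow {E Q : Type*} [NormedAddCommGroup E]
    {z : Q → E} {r : ℝ} (hr : r < 0) (hz : ∀ q, z q ≠ 0)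
    (hs : Summable fun q => ‖z q‖ ^ r) : ∃ δ > 0, ∀ q, δ ≤ ‖z q‖ := by
  have hT : 0 ≤ ∑' q, ‖z q‖ ^ r := tsum_nonneg fun q => by positivity
  refine ⟨((∑' q, ‖z q‖ ^ r) + 1) ^ (1 / r), by positivity, fun q => ?_⟩
  have hq : 0 < ‖z q‖ := norm_pos_iff.mpr (hz q)
  have h : ‖z q‖ ^ r ≤ (∑' q, ‖z q‖ ^ r) + 1 :=
    (hs.le_tsum q fun _ _ => by positivity).trans (by linarith)
  calc ((∑' q, ‖z q‖ ^ r) + 1) ^ (1 / r) ≤ (‖z q‖ ^ r) ^ (1 / r) :=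
        Real.rpow_le_rpow_of_nonpos (by positivity) h (one_div_neg.mpr hr).le
    _ = ‖z q‖ := by rw [← Real.rpow_mul hq.le, mul_one_div_cancel hr.ne, Real.rpow_one]

section NewtonKernel

set_option maxSynthPendingDepth 3

variable {E : Type*} [NormedAddCommGroup E] [InnerProductSpace ℝ E]

variable (E) in
/-- The real inner product as a continuous bilinear map. -/
def realInnerCLM : E →L[ℝ] E →L[ℝ] ℝ := innerSL ℝ

theorem realInnerCLM_apply_apply (x y : E) : realInnerCLM E x y = inner ℝ x y := rfl

theorem norm_realInnerCLM_apply (x : E) : ‖realInnerCLM E x‖ = ‖x‖ := innerSL_apply_norm ℝ x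

theorem hasFDerivAt_norm_rpow_of_ne_zero (r : ℝ) {z : E} (hz : z ≠ 0) :
    HasFDerivAt (fun z : E => ‖z‖ ^ r) ((r * ‖z‖ ^ (r - 2)) • realInnerCLM E z) z := by
  have hz' : 0 < ‖z‖ := norm_pos_iff.mpr hz
  have h := (hasStrictFDerivAt_norm_sq z).hasFDerivAt.rpow_const (p := r / 2)
    (Or.inl (by positivity))
  convert h using 1
  · ext w
    rw [← Real.rpow_natCast_mul (norm_nonneg w)]
    congr 1; push_cast; ring
  · rw [← Real.rpow_natCast_mul (norm_nonneg z), ← Nat.cast_smul_eq_nsmul ℝ, smul_smul]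
    congr 1
    push_cast
    rw [show (2 : ℝ) * (r / 2 - 1) = r - 2 by ring]
    ring

/-- The derivative of `z ↦ ‖z‖ ^ r`. -/
def normRpowFDeriv (r : ℝ) (z : E) : E →L[ℝ] ℝ := (r * ‖z‖ ^ (r - 2)) • realInnerCLM E z

/-- The second derivative of `z ↦ ‖z‖ ^ r`. -/
def normRpowFDeriv₂ (r : ℝ) (z : E) : E →L[ℝ] E →L[ℝ] ℝ :=
  (r * ‖z‖ ^ (r - 2)) • realInnerCLM E +
    ((r * ((r - 2) * ‖z‖ ^ (r - 2 - 2))) • realInnerCLM E z).smulRight (realInnerCLM E z)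

theorem hasFDerivAt_normRpowFDeriv (r : ℝ) {z : E} (hz : z ≠ 0) :
    HasFDerivAt (normRpowFDeriv r) (normRpowFDeriv₂ r z) z := by
  have h := ((hasFDerivAt_norm_rpow_of_ne_zero (r - 2) hz).const_mul r).smul
    ((realInnerCLM E).hasFDerivAt (x := z))
  exact h.congr_fderiv (by rw [normRpowFDeriv₂, smul_smul])

theorem norm_normRpowFDeriv_le (r : ℝ) (z : E) :
    ‖normRpowFDeriv r z‖ ≤ |r| * (‖z‖ ^ (r - 2) * ‖z‖) := by
  rw [normRpowFDeriv, norm_smul, norm_realInnerCLM_apply, norm_mul, Real.norm_eq_abs,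
    Real.norm_of_nonneg (by positivity), mul_assoc]

theorem norm_normRpowFDeriv₂_le (r : ℝ) {z : E} (hz : z ≠ 0) :
    ‖normRpowFDeriv₂ r z‖ ≤ (|r| + |r| * |r - 2|) * ‖z‖ ^ (r - 2) := by
  have hz' : 0 < ‖z‖ := norm_pos_iff.mpr hz
  have h4 : ‖z‖ ^ (r - 2) = ‖z‖ ^ (r - 2 - 2) * ‖z‖ ^ 2 := by
    rw [← Real.rpow_add_natCast hz'.ne']; norm_num
  rw [normRpowFDeriv₂, add_mul]
  refine norm_add_le_of_le ?_ ?_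
  · rw [norm_smul, norm_mul, Real.norm_eq_abs, Real.norm_of_nonneg (by positivity)]
    refine mul_le_of_le_one_right (by positivity) (norm_innerSL_le ℝ (E := E))
  · rw [ContinuousLinearMap.norm_smulRight_apply, norm_smul, norm_realInnerCLM_apply, norm_mul,
      norm_mul, Real.norm_eq_abs, Real.norm_eq_abs,
      Real.norm_of_nonneg (by positivity : 0 ≤ ‖z‖ ^ (r - 2 - 2)), h4]
    apply le_of_eq; ring

theorem continuousAt_normRpowFDeriv₂ (r : ℝ) {z : E} (hz : z ≠ 0) :
    ContinuousAt (normRpowFDeriv₂ r) z := by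
  have hz' : ‖z‖ ≠ 0 := norm_ne_zero_iff.mpr hz
  have hp : ∀ s : ℝ, ContinuousAt (fun z : E => ‖z‖ ^ s) z := fun s =>
    continuousAt_id.norm.rpow_const (Or.inl hz')
  have hi : ContinuousAt (fun z : E => realInnerCLM E z) z :=
    (realInnerCLM E).continuous.continuousAt
  have hc : ContinuousAt (fun z : E =>
      (r * ((r - 2) * ‖z‖ ^ (r - 2 - 2))) • realInnerCLM E z) z :=
    (continuousAt_const.mul (continuousAt_const.mul (hp _))).smul hi
  have h1 : ContinuousAt (fun z : E => (r * ‖z‖ ^ (r - 2)) • realInnerCLM E) z :=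
    (continuousAt_const.mul (hp _)).smul continuousAt_const
  exact h1.add (((ContinuousLinearMap.smulRightL ℝ E (E →L[ℝ] ℝ)).continuous.continuousAt.comp
    hc).clm_apply hi)

/-- `z ↦ ‖z‖ ^ (2 - n)` is harmonic away from the origin. -/
theorem sum_normRpowFDeriv₂_eq_zero {ι : Type*} [Fintype ι] (b : OrthonormalBasis ι ℝ E) {z : E}
    (hz : z ≠ 0) :
    ∑ j, normRpowFDeriv₂ (2 - (Fintype.card ι : ℝ)) z (b j) (b j) = 0 := by
  have hz' : 0 < ‖z‖ := norm_pos_iff.mpr hz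
  set r := 2 - (Fintype.card ι : ℝ)
  have h4 : ‖z‖ ^ (r - 2) = ‖z‖ ^ (r - 2 - 2) * ‖z‖ ^ 2 := by
    rw [← Real.rpow_add_natCast hz'.ne']; norm_num
  have hs : ∑ j, inner ℝ z (b j) * inner ℝ z (b j) = ‖z‖ ^ 2 := by
    rw [← b.sum_sq_norm_inner_left z]
    exact Finset.sum_congr rfl fun j _ => by rw [Real.norm_eq_abs, sq_abs, sq, real_inner_comm]
  have hb : ∀ j, inner ℝ (b j) (b j) = (1 : ℝ) := fun j => by
    rw [real_inner_self_eq_norm_sq, b.norm_eq_one]; norm_num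
  have key : ∀ j, normRpowFDeriv₂ r z (b j) (b j) =
      r * ‖z‖ ^ (r - 2) + r * ((r - 2) * ‖z‖ ^ (r - 2 - 2)) *
        (inner ℝ z (b j) * inner ℝ z (b j)) := fun j => by
    simp only [normRpowFDeriv₂, add_apply, smul_apply,
      ContinuousLinearMap.smulRight_apply, realInnerCLM_apply_apply, smul_eq_mul]
    rw [hb]; ring
  simp_rw [key, Finset.sum_add_distrib, ← Finset.mul_sum, hs, Finset.sum_const, Finset.card_univ,
    nsmul_eq_mul, h4]
  simp only [r]; ring

/-- A series `∑ ‖x - a q‖ ^ r` with `r < 0` which converges at a point `x₀` away from the poles may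
be differentiated twice termwise near `x₀`. -/
theorem exists_nhds_hasFDerivAt_tsum_norm_sub_rpow {Q : Type*} {a : Q → E} {r : ℝ} {x₀ : E}
    (hr : r < 0) (hx₀ : ∀ q, x₀ ≠ a q) (hs : Summable fun q => ‖x₀ - a q‖ ^ r) :
    ∃ u ∈ 𝓝 x₀,
      (∀ x ∈ u, HasFDerivAt (fun x => ∑' q, ‖x - a q‖ ^ r)
        (∑' q, normRpowFDeriv r (x - a q)) x) ∧
      (∀ x ∈ u, HasFDerivAt (fun x => ∑' q, normRpowFDeriv r (x - a q))
        (∑' q, normRpowFDeriv₂ r (x - a q)) x) ∧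
      ContinuousOn (fun x => ∑' q, normRpowFDeriv₂ r (x - a q)) u ∧
      (∀ x ∈ u, (∀ q, x ≠ a q) ∧ Summable fun q => normRpowFDeriv₂ r (x - a q)) := by
  obtain ⟨δ, hδ, hδa⟩ := exists_pos_le_norm_of_summable_norm_rpow hr
    (fun q => sub_ne_zero.mpr (hx₀ q)) hs
  have hfar : ∀ q, ∀ x ∈ Metric.ball x₀ (δ / 2),
      δ / 2 ≤ ‖x - a q‖ ∧ ‖x₀ - a q‖ / 2 ≤ ‖x - a q‖ := fun q x hx => by
    rw [mem_ball_iff_norm'] at hx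
    have h1 := norm_sub_le_norm_sub_add_norm_sub x₀ x (a q)
    have h2 := hδa q
    constructor <;> linarith
  have hne : ∀ q, ∀ x ∈ Metric.ball x₀ (δ / 2), x - a q ≠ 0 := fun q x hx =>
    norm_pos_iff.mp ((half_pos hδ).trans_le (hfar q x hx).1)
  have hbound : ∀ c : ℝ, 0 ≤ c → ∀ q, ∀ x ∈ Metric.ball x₀ (δ / 2),
      ‖x - a q‖ ^ (r - c) ≤ (δ / 2) ^ (-c) * ((1 / 2) ^ r * ‖x₀ - a q‖ ^ r) :=
    fun c hc q x hx => Real.rpow_sub_le_of_half_le hr.le hc (half_pos hδ)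
      (hδ.trans_le (hδa q)) (hfar q x hx).1 (hfar q x hx).2
  have hsum : ∀ C c : ℝ, Summable fun q =>
      C * ((δ / 2) ^ (-c) * ((1 / 2) ^ r * ‖x₀ - a q‖ ^ r)) :=
    fun C c => ((hs.mul_left _).mul_left _).mul_left _
  have hb1 : ∀ q, ∀ x ∈ Metric.ball x₀ (δ / 2), ‖normRpowFDeriv r (x - a q)‖ ≤
      |r| * ((δ / 2) ^ (-(1 : ℝ)) * ((1 / 2) ^ r * ‖x₀ - a q‖ ^ r)) := fun q x hx => by
    refine (norm_normRpowFDeriv_le r _).trans ?_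
    rw [← Real.rpow_add_one (norm_ne_zero_iff.mpr (hne q x hx)), show r - 2 + 1 = r - 1 by ring]
    exact mul_le_mul_of_nonneg_left (hbound 1 zero_le_one q x hx) (abs_nonneg r)
  have hb2 : ∀ q, ∀ x ∈ Metric.ball x₀ (δ / 2), ‖normRpowFDeriv₂ r (x - a q)‖ ≤
      (|r| + |r| * |r - 2|) * ((δ / 2) ^ (-(2 : ℝ)) * ((1 / 2) ^ r * ‖x₀ - a q‖ ^ r)) :=
    fun q x hx => (norm_normRpowFDeriv₂_le r (hne q x hx)).trans
      (mul_le_mul_of_nonneg_left (hbound 2 zero_le_two q x hx) (by positivity))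
  have hd1 : ∀ q, ∀ x ∈ Metric.ball x₀ (δ / 2),
      HasFDerivAt (fun x => ‖x - a q‖ ^ r) (normRpowFDeriv r (x - a q)) x := fun q x hx =>
    (hasFDerivAt_comp_sub (a q)).mpr (hasFDerivAt_norm_rpow_of_ne_zero r (hne q x hx))
  have hd2 : ∀ q, ∀ x ∈ Metric.ball x₀ (δ / 2),
      HasFDerivAt (fun x => normRpowFDeriv r (x - a q)) (normRpowFDeriv₂ r (x - a q)) x :=
    fun q x hx => (hasFDerivAt_comp_sub (a q)).mpr (hasFDerivAt_normRpowFDeriv r (hne q x hx))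
  have hmem : x₀ ∈ Metric.ball x₀ (δ / 2) := Metric.mem_ball_self (half_pos hδ)
  have hconn : IsPreconnected (Metric.ball x₀ (δ / 2)) := (convex_ball _ _).isPreconnected
  refine ⟨Metric.ball x₀ (δ / 2), Metric.ball_mem_nhds _ (half_pos hδ), fun x hx => ?_,
    fun x hx => ?_, ?_, fun x hx => ⟨fun q => sub_ne_zero.mp (hne q x hx), ?_⟩⟩
  · exact hasFDerivAt_tsum_of_isPreconnected (hsum _ _) Metric.isOpen_ball hconn hd1 hb1 hmem hs hx
  · exact hasFDerivAt_tsum_of_isPreconnected (hsum _ _) Metric.isOpen_ball hconn hd2 hb2 hmem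
      ((hsum _ _).of_norm_bounded fun q => hb1 q x₀ hmem) hx
  · refine continuousOn_tsum (fun q x hx => ?_) (hsum _ _) hb2
    exact (ContinuousAt.comp (f := fun x => x - a q) (continuousAt_normRpowFDeriv₂ r (hne q x hx))
      (continuousAt_id.sub continuousAt_const)).continuousWithinAt
  · exact (hsum _ _).of_norm_bounded fun q => hb2 q x hx

theorem contDiffAt_tsum_norm_sub_rpow {Q : Type*} {a : Q → E} {r : ℝ} {x₀ : E}
    (hr : r < 0) (hx₀ : ∀ q, x₀ ≠ a q) (hs : Summable fun q => ‖x₀ - a q‖ ^ r) :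
    ContDiffAt ℝ 2 (fun x => ∑' q, ‖x - a q‖ ^ r) x₀ := by
  obtain ⟨u, hu, h1, h2, hc, -⟩ := exists_nhds_hasFDerivAt_tsum_norm_sub_rpow hr hx₀ hs
  exact contDiffAt_succ_iff_hasFDerivAt (n := 1).mpr
    ⟨_, ⟨u, hu, h1⟩, contDiffAt_one_iff.mpr ⟨_, u, hu, hc, h2⟩⟩

theorem laplacian_tsum_norm_sub_rpow_eq_zero {ι Q : Type*} [Fintype ι] (b : OrthonormalBasis ι ℝ E)
    {a : Q → E} {x₀ : E} (hι : 2 < Fintype.card ι) (hx₀ : ∀ q, x₀ ≠ a q)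
    (hs : Summable fun q => ‖x₀ - a q‖ ^ (2 - (Fintype.card ι : ℝ))) :
    ∑ j, fderiv ℝ (fun z => fderiv ℝ
      (fun x => ∑' q, ‖x - a q‖ ^ (2 - (Fintype.card ι : ℝ))) z (b j)) x₀ (b j) = 0 := by
  have hr : 2 - (Fintype.card ι : ℝ) < 0 := sub_neg.mpr (mod_cast hι)
  obtain ⟨u, hu, h1, h2, -, h3⟩ := exists_nhds_hasFDerivAt_tsum_norm_sub_rpow hr hx₀ hs
  have hmem := mem_of_mem_nhds hu
  set r := 2 - (Fintype.card ι : ℝ)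
  have hj : ∀ j, HasSum (fun q => normRpowFDeriv₂ r (x₀ - a q) (b j) (b j))
      (fderiv ℝ (fun z => fderiv ℝ (fun x => ∑' q, ‖x - a q‖ ^ r) z (b j)) x₀ (b j)) := by
    intro j
    have he : (fun z => fderiv ℝ (fun x => ∑' q, ‖x - a q‖ ^ r) z (b j)) =ᶠ[𝓝 x₀]
        fun z => (∑' q, normRpowFDeriv r (z - a q)) (b j) := by
      filter_upwards [hu] with z hz
      rw [(h1 z hz).fderiv]
    have hd : HasFDerivAt (fun z => (∑' q, normRpowFDeriv r (z - a q)) (b j))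
        ((ContinuousLinearMap.apply ℝ ℝ (b j)).comp (∑' q, normRpowFDeriv₂ r (x₀ - a q))) x₀ :=
      (ContinuousLinearMap.apply ℝ ℝ (b j)).hasFDerivAt.comp x₀ (h2 x₀ hmem)
    rw [he.fderiv_eq, hd.fderiv]
    exact ((h3 x₀ hmem).2.hasSum.mapL (ContinuousLinearMap.apply ℝ (E →L[ℝ] ℝ) (b j))).mapL
      (ContinuousLinearMap.apply ℝ ℝ (b j))
  refine (hasSum_sum fun j _ => hj j).unique ?_
  convert hasSum_zero with q
  exact sum_normRpowFDeriv₂_eq_zero b (sub_ne_zero.mpr (hx₀ q))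

end NewtonKernel

section Reflections

variable {n k p : ℕ}

theorem Rflip_apply (ε : Fin n → Bool) (x : Euc n) (j : Fin n) :
    Rflip ε x j = if ε j = true then -x j else x j := by
  have : (∑ i ∈ Finset.univ.filter (fun i : Fin n => ε i = true),
      (2 * x i) • EuclideanSpace.single i (1 : ℝ)) j = if ε j = true then 2 * x j else 0 := by
    simp [Finset.sum_apply, Pi.single_apply, Finset.sum_ite_eq]
  rw [Rflip, PiLp.sub_apply, this]
  split_ifs <;> ring

theorem Rflip_add (ε : Fin n → Bool) (x y : Euc n) : Rflip ε (x + y) = Rflip ε x + Rflip ε y := by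
  ext j
  simp only [Rflip_apply, PiLp.add_apply]
  split_ifs <;> ring

theorem Rflip_Rflip (ε δ : Fin n → Bool) (x : Euc n) :
    Rflip ε (Rflip δ x) = Rflip (fun j => xor (ε j) (δ j)) x := by
  ext j
  simp only [Rflip_apply]
  cases ε j <;> cases δ j <;> simp

theorem norm_Rflip (ε : Fin n → Bool) (x : Euc n) : ‖Rflip ε x‖ = ‖x‖ := by
  rw [EuclideanSpace.norm_eq, EuclideanSpace.norm_eq]
  congr 1
  refine Finset.sum_congr rfl fun j _ => ?_
  rw [Rflip_apply]
  split_ifs <;> simp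

theorem Rflip_involutive (ε : Fin n → Bool) : Function.Involutive (Rflip ε) := fun x => by
  ext j
  simp only [Rflip_apply]
  split_ifs <;> simp

theorem SignWindow.xor {ε δ : Fin n → Bool} (hε : SignWindow n k p ε) (hδ : SignWindow n k p δ) :
    SignWindow n k p (fun j => xor (ε j) (δ j)) := fun j hj => by
  cases hj' : ε j
  · exact hδ j (by simpa [hj'] using hj)
  · exact hε j hj'

/-- Composition with the reflection `R_δ` permutes the sign patterns. -/
def signWindowXorEquiv {δ : Fin n → Bool} (hδ : SignWindow n k p δ) :
    {ε : Fin n → Bool // SignWindow n k p ε} ≃ {ε : Fin n → Bool // SignWindow n k p ε} :=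
  Function.Involutive.toPerm (fun ε => ⟨fun j => xor (ε.1 j) (δ j), ε.2.xor hδ⟩) fun ε => by
    ext j; simp

theorem Rflip_eq_self {ε : Fin n → Bool} (hε : SignWindow n k p ε) {x : Euc n}
    (hx : ∀ j : Fin n, k ≤ (j : ℕ) → x j = 0) : Rflip ε x = x := by
  ext j
  rw [Rflip_apply]
  split_ifs with h
  · rw [hx j (hε j h).1, neg_zero]
  · rfl

end Reflections

section Lattice

variable {n k : ℕ} {v : Fin k → Euc n}

theorem latt_apply_eq_zero (hv0 : ∀ (i : Fin k) (j : Fin n), k ≤ (j : ℕ) → v i j = 0)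
    (m : Fin k → ℤ) (j : Fin n) (hj : k ≤ (j : ℕ)) : latt v m j = 0 := by
  simp [latt, hv0 _ j hj]

theorem latt_add_single (m : Fin k → ℤ) (i : Fin k) :
    latt v (m + Pi.single i 1) = v i + latt v m := by
  simp [latt, add_smul, Finset.sum_add_distrib, Pi.single_apply, ite_smul, add_comm]

theorem discreteTopology_span_int_of_linearIndependent (hv : LinearIndependent ℝ v) :
    DiscreteTopology (Submodule.span ℤ (Set.range v)) := by
  let b := Module.Basis.extend hv.linearIndepOn_id
  have hle : Submodule.span ℤ (Set.range v) ≤ Submodule.span ℤ (Set.range b) :=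
    Submodule.span_mono <| by
      rw [Module.Basis.range_extend]
      exact hv.linearIndepOn_id.subset_extend _
  have : Finite (hv.linearIndepOn_id.extend (Set.subset_univ _)) := Module.Finite.finite_basis b
  exact DiscreteTopology.of_subset (s := (Submodule.span ℤ (Set.range b) : Set (Euc n)))
    (inferInstanceAs (DiscreteTopology (Submodule.span ℤ (Set.range b)))) hle

theorem summable_norm_latt_sub_rpow (hv : LinearIndependent ℝ v) {r : ℝ} (hr : r < -(k : ℝ))
    (c : Euc n) : Summable fun m : Fin k → ℤ => ‖latt v m - c‖ ^ r := by
  have hd := discreteTopology_span_int_of_linearIndependent hv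
  have hv' : LinearIndependent ℤ v := hv.restrict_scalars' ℤ
  let b := Module.Basis.span hv'
  have hrank : Module.finrank ℤ (Submodule.span ℤ (Set.range v)) = k := by
    rw [Module.finrank_eq_card_basis b, Fintype.card_fin]
  have h := ZLattice.summable_norm_sub_rpow (Submodule.span ℤ (Set.range v)) r
    (by rwa [hrank]) c
  refine (b.equivFun.symm.toEquiv.summable_iff.mpr h).congr fun m => ?_
  simp [b, latt, Module.Basis.equivFun_symm_apply, Module.Basis.span_apply, Int.cast_smul_eq_zsmul]

end Lattice

section ProjectiveCylinder

variable {n k p : ℕ} {v : Fin k → Euc n}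

theorem norm_Rflip_add_latt_sub
    (hv0 : ∀ (i : Fin k) (j : Fin n), k ≤ (j : ℕ) → v i j = 0) {ε : Fin n → Bool}
    (hε : SignWindow n k p ε) (m : Fin k → ℤ) (x y : Euc n) :
    ‖Rflip ε x + latt v m - y‖ = ‖x - (Rflip ε y - latt v m)‖ := by
  have hω : Rflip ε (latt v m) = latt v m := Rflip_eq_self hε (latt_apply_eq_zero hv0 m)
  rw [← norm_Rflip ε (x - _)]
  congr 1
  have h := Rflip_add ε (x - (Rflip ε y - latt v m)) (Rflip ε y - latt v m)
  have h' := Rflip_add ε (Rflip ε y - latt v m) (latt v m)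
  rw [sub_add_cancel] at h h'
  rw [Rflip_involutive ε y, hω] at h'
  rw [h, add_assoc, ← h', add_sub_cancel_right]

theorem summable_norm_Rflip_add_latt_sub_rpow (hv : LinearIndependent ℝ v) {r : ℝ}
    (hr : r < -(k : ℝ)) (x y : Euc n) :
    Summable fun q : {ε : Fin n → Bool // SignWindow n k p ε} × (Fin k → ℤ) =>
      ‖Rflip (q.1 : Fin n → Bool) x + latt v q.2 - y‖ ^ r := by
  refine (summable_prod_of_nonneg fun q => by positivity).mpr ⟨fun ε => ?_, .of_finite⟩
  refine (summable_norm_latt_sub_rpow hv hr (y - Rflip ε.1 x)).congr fun m => ?_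
  congr 2
  abel

theorem tsum_norm_Rflip_add_latt_sub_rpow_add
    (hv0 : ∀ (i : Fin k) (j : Fin n), k ≤ (j : ℕ) → v i j = 0) (r : ℝ) (x y : Euc n) (i : Fin k) :
    ∑' q : {ε : Fin n → Bool // SignWindow n k p ε} × (Fin k → ℤ),
        ‖Rflip (q.1 : Fin n → Bool) (x + v i) + latt v q.2 - y‖ ^ r =
      ∑' q : {ε : Fin n → Bool // SignWindow n k p ε} × (Fin k → ℤ),
        ‖Rflip (q.1 : Fin n → Bool) x + latt v q.2 - y‖ ^ r := by
  rw [← ((Equiv.refl {ε : Fin n → Bool // SignWindow n k p ε}).prodCongr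
    (Equiv.addRight (Pi.single i (1 : ℤ)))).tsum_eq fun q =>
      ‖Rflip (q.1 : Fin n → Bool) x + latt v q.2 - y‖ ^ r]
  refine tsum_congr fun q => ?_
  simp only [Equiv.prodCongr_apply, Equiv.coe_refl, Prod.map_fst, Prod.map_snd, id_eq,
    Equiv.coe_addRight]
  rw [latt_add_single, Rflip_add, Rflip_eq_self q.1.2 (hv0 i), add_assoc]

theorem tsum_norm_Rflip_Rflip_add_latt_sub_rpow (r : ℝ) (x y : Euc n) {δ : Fin n → Bool}
    (hδ : SignWindow n k p δ) :
    ∑' q : {ε : Fin n → Bool // SignWindow n k p ε} × (Fin k → ℤ),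
        ‖Rflip (q.1 : Fin n → Bool) (Rflip δ x) + latt v q.2 - y‖ ^ r =
      ∑' q : {ε : Fin n → Bool // SignWindow n k p ε} × (Fin k → ℤ),
        ‖Rflip (q.1 : Fin n → Bool) x + latt v q.2 - y‖ ^ r := by
  rw [← ((signWindowXorEquiv hδ).prodCongr (Equiv.refl (Fin k → ℤ))).tsum_eq fun q =>
      ‖Rflip (q.1 : Fin n → Bool) x + latt v q.2 - y‖ ^ r]
  refine tsum_congr fun q => ?_
  rw [Rflip_Rflip]
  rfl

end ProjectiveCylinder

/-- Harmonic Green's kernel of the projective cylinder `M_{k,p}`: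
for `n ≥ 4`, `1 ≤ k ≤ n-3`, `k+1 ≤ p ≤ n`, a rank-`k` lattice `Λ` whose generators have
vanishing coordinates `k+1,…,n`, and the sign flips `R_ε`, `ε ∈ {±1}^{p-k}`:
(i) the family `(|R_ε(x)+ω-y|^{2-n})_{(ε,ω)}` is summable whenever `R_ε(x)+ω ≠ y` for all
`(ε,ω)`, so `K(x,y) = Σ_ε Σ_{ω∈Λ} |R_ε(x)+ω-y|^{2-n}` is well defined; (ii) `K` is
`Λ`-periodic in `x`; (iii) `K(R_δ(x),y) = K(x,y)` for every sign pattern `δ`; (iv) for fixed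
`y`, `x ↦ K(x,y)` is harmonic off the singular set. -/
theorem stmt15 (n k p : ℕ) (hn : 4 ≤ n) (hk1 : 1 ≤ k) (hk2 : k ≤ n - 3)
    (hp1 : k + 1 ≤ p) (hp2 : p ≤ n)
    (v : Fin k → Euc n) (hv : LinearIndependent ℝ v)
    (hv0 : ∀ (i : Fin k) (j : Fin n), k ≤ (j : ℕ) → v i j = 0)
    (K : Euc n → Euc n → ℝ)
    (hK : ∀ x y : Euc n,
      K x y = ∑' q : {ε : Fin n → Bool // SignWindow n k p ε} × (Fin k → ℤ),
        ‖Rflip (q.1 : Fin n → Bool) x + latt v q.2 - y‖ ^ (2 - (n : ℝ))) :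
    -- (i) summability
    (∀ x y : Euc n,
      (∀ (ε : Fin n → Bool), SignWindow n k p ε → ∀ m : Fin k → ℤ,
        Rflip ε x + latt v m ≠ y) →
      Summable (fun q : {ε : Fin n → Bool // SignWindow n k p ε} × (Fin k → ℤ) =>
        ‖Rflip (q.1 : Fin n → Bool) x + latt v q.2 - y‖ ^ (2 - (n : ℝ)))) ∧
    -- (ii) lattice periodicity
    (∀ x y : Euc n,
      (∀ (ε : Fin n → Bool), SignWindow n k p ε → ∀ m : Fin k → ℤ,
        Rflip ε x + latt v m ≠ y) →
      ∀ i : Fin k, K (x + v i) y = K x y) ∧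
    -- (iii) reflection invariance
    (∀ x y : Euc n,
      (∀ (ε : Fin n → Bool), SignWindow n k p ε → ∀ m : Fin k → ℤ,
        Rflip ε x + latt v m ≠ y) →
      ∀ δ : Fin n → Bool, SignWindow n k p δ → K (Rflip δ x) y = K x y) ∧
    -- (iv) harmonicity in x for fixed y
    (∀ y : Euc n,
      ContDiffOn ℝ 2 (fun x => K x y)
        {x | ∀ (ε : Fin n → Bool), SignWindow n k p ε → ∀ m : Fin k → ℤ,
          Rflip ε x + latt v m ≠ y} ∧
      ∀ x : Euc n,
        (∀ (ε : Fin n → Bool), SignWindow n k p ε → ∀ m : Fin k → ℤ,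
          Rflip ε x + latt v m ≠ y) →
        ∑ j : Fin n,
          fderiv ℝ (fun z => fderiv ℝ (fun x' => K x' y) z (EuclideanSpace.single j 1)) x
            (EuclideanSpace.single j 1) = 0) := by
  have hr : 2 - (n : ℝ) < -(k : ℝ) := by
    have : (k : ℝ) + 3 ≤ n := by exact_mod_cast (by omega : k + 3 ≤ n)
    linarith
  have hsum := fun x y : Euc n => summable_norm_Rflip_add_latt_sub_rpow (p := p) hv hr x y
  refine ⟨fun x y _ => hsum x y, fun x y _ i => ?_, fun x y _ δ hδ => ?_, fun y => ?_⟩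
  · rw [hK, hK, tsum_norm_Rflip_add_latt_sub_rpow_add hv0]
  · rw [hK, hK, tsum_norm_Rflip_Rflip_add_latt_sub_rpow _ _ _ hδ]
  · let a : {ε : Fin n → Bool // SignWindow n k p ε} × (Fin k → ℤ) → Euc n :=
      fun q => Rflip q.1.1 y - latt v q.2
    have hnorm : ∀ x q, ‖Rflip (q.1 : Fin n → Bool) x + latt v q.2 - y‖ = ‖x - a q‖ :=
      fun x q => norm_Rflip_add_latt_sub hv0 q.1.2 q.2 x y
    have hKa : (fun x => K x y) = fun x => ∑' q, ‖x - a q‖ ^ (2 - (n : ℝ)) := by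
      funext x
      simp only [hK, hnorm]
    have hsa : ∀ x, Summable fun q => ‖x - a q‖ ^ (2 - (n : ℝ)) := fun x => by
      simpa only [hnorm] using hsum x y
    have hne : ∀ x : Euc n, (∀ (ε : Fin n → Bool), SignWindow n k p ε → ∀ m : Fin k → ℤ,
        Rflip ε x + latt v m ≠ y) → ∀ q, x ≠ a q := fun x hx q hq => by
      refine hx q.1.1 q.1.2 q.2 (sub_eq_zero.mp (norm_eq_zero.mp ?_))
      rw [hnorm, ← hq, sub_self, norm_zero]
    rw [hKa]
    refine ⟨fun x hx => (contDiffAt_tsum_norm_sub_rpow ?_ (hne x hx) (hsa x)).contDiffWithinAt,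
      fun x hx => ?_⟩
    · linarith [(k.cast_nonneg : (0 : ℝ) ≤ k)]
    · have h := laplacian_tsum_norm_sub_rpow_eq_zero (EuclideanSpace.basisFun (Fin n) ℝ)
        (by rw [Fintype.card_fin]; omega) (hne x hx) (by simpa only [Fintype.card_fin] using hsa x)
      simpa only [Fintype.card_fin, EuclideanSpace.basisFun_apply] using h
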